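/- Let s, d ≥ 1 be natural numbers, let δ ≥ 1 be real, let b ∈ (0,∞)^s, and let M, K : ℝ^s → ℝ^{d×d} be C^∞ matrix-valued functions. Suppose there are constants C_M ≥ 1 and C_K > 0 such that for every multi-index ν ∈ ℕ^s and every y ∈ ℝ^s, ‖∂^ν M(y)‖_F ≤ C_M · b^ν · [1/2]_{|ν|} · (|ν|!)^{δ−1} and ‖∂^ν K(y)‖_F ≤ C_K · b^ν · [1/2]_{|ν|} · (|ν|!)^{δ−1}. Then for every multi-index ν ∈ ℕ^s and every y ∈ ℝ^s, ‖∂^ν (M·K)(y)‖_F ≤ 4 · C_M · C_K · b^ν · [1/2]_{|ν|} · (|ν|!)^{δ−1}, where M·K denotes the pointwise matrix product. -/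

import Mathlib

/-- The absolute falling factorial `[1/2]_n`: `[1/2]_0 = 1`, and
`[1/2]_{n+1} = |n - 1/2| * [1/2]_n`, so that `[1/2]_1 = 1/2`. -/
noncomputable def gd : ℕ → ℝ
  | 0 => 1
  | n + 1 => |(n : ℝ) - 1 / 2| * gd n

/-- Partial derivative along the `j`-th coordinate direction:
`∂_j f (y)` is the derivative at `t = 0` of `t ↦ f (y + t e_j)`. -/
noncomputable def pd {s : ℕ} (j : Fin s) (f : (Fin s → ℝ) → ℝ) : (Fin s → ℝ) → ℝ :=
  fun y => deriv (fun t : ℝ => f (y + t • (Pi.single j 1 : Fin s → ℝ))) 0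

/-- Iterated partial derivative `∂^ν f = ∂₁^{ν₁} ⋯ ∂_s^{ν_s} f`. -/
noncomputable def pdMulti {s : ℕ} (ν : Fin s → ℕ) (f : (Fin s → ℝ) → ℝ) :
    (Fin s → ℝ) → ℝ :=
  (List.finRange s).foldr (fun j g => (pd j)^[ν j] g) f

/-- The Frobenius norm `‖A‖_F = (Σ_{i,j} A_{ij}²)^{1/2}` of a real matrix. -/
noncomputable def frob {d : ℕ} (A : Matrix (Fin d) (Fin d) ℝ) : ℝ :=
  Real.sqrt (∑ i, ∑ j, (A i j) ^ 2)

/-- Entrywise iterated partial derivative `∂^ν M` of a matrix-valued function. -/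
noncomputable def pdMat {s d : ℕ} (ν : Fin s → ℕ)
    (M : (Fin s → ℝ) → Matrix (Fin d) (Fin d) ℝ) :
    (Fin s → ℝ) → Matrix (Fin d) (Fin d) ℝ :=
  fun y => Matrix.of fun i j => pdMulti ν (fun z => M z i j) y

/-- All ways to split a word into two complementary subwords. -/
def splits {α : Type} : List α → List (List α × List α)
  | [] => [([], [])]
  | a :: w => (splits w).map (fun p => (a :: p.1, p.2)) ++ (splits w).map (fun p => (p.1, a :: p.2))

/-- iterated partial derivative along a word -/
noncomputable def Dw {s : ℕ} (w : List (Fin s)) (f : (Fin s → ℝ) → ℝ) : (Fin s → ℝ) → ℝ :=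
  w.foldr pd f

theorem splits_sum_cons {α : Type} (a : α) (w : List α) (φ : List α × List α → ℝ) :
    ((splits (a :: w)).map φ).sum =
      ((splits w).map (fun p => φ (a :: p.1, p.2) + φ (p.1, a :: p.2))).sum := by
  simp [splits, List.sum_map_add, Function.comp_def]

theorem mem_splits {α : Type} (w : List α) (p : List α × List α) (hp : p ∈ splits w) :
    p.1.Sublist w ∧ p.2.Sublist w ∧ (p.1 ++ p.2).Perm w := by
  induction w generalizing p with
  | nil => simp [splits] at hp; subst hp; simp
  | cons a w ih =>
    simp only [splits, List.mem_append, List.mem_map] at hp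
    rcases hp with ⟨q, hq, rfl⟩ | ⟨q, hq, rfl⟩
    · obtain ⟨h1, h2, h3⟩ := ih q hq
      exact ⟨h1.cons_cons a, h2.cons a, h3.cons a⟩
    · obtain ⟨h1, h2, h3⟩ := ih q hq
      exact ⟨h1.cons a, h2.cons_cons a, List.perm_middle.trans (h3.cons a)⟩

/-- signed version of gd -/
noncomputable def ge (n : ℕ) : ℝ := gd n - if n = 0 then 2 else 0

theorem ge_succ (n : ℕ) : ge (n + 1) = ((n : ℝ) - 1 / 2) * ge n := by
  rcases n with _ | n
  · simp [ge, gd]; norm_num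
  · have h : (0 : ℝ) ≤ ((n + 1 : ℕ) : ℝ) - 1 / 2 := by
      push_cast
      have : (0 : ℝ) ≤ n := Nat.cast_nonneg n
      linarith
    have h2 : gd (n + 1 + 1) = |((n + 1 : ℕ) : ℝ) - 1 / 2| * gd (n + 1) := rfl
    simp only [ge, h2, abs_of_nonneg h]
    simp

theorem gd_nonneg (n : ℕ) : 0 ≤ gd n := by
  induction n with
  | zero => simp [gd]
  | succ n ih => exact mul_nonneg (abs_nonneg _) ih

theorem T_succ {α : Type} (a : α) (w : List α) :
    ((splits (a :: w)).map (fun p => ge p.1.length * ge p.2.length)).sum =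
      ((w.length : ℝ) - 1) * ((splits w).map (fun p => ge p.1.length * ge p.2.length)).sum := by
  rw [splits_sum_cons, ← List.sum_map_mul_left]
  congr 1
  apply List.map_congr_left
  intro p hp
  have h := (mem_splits w p hp).2.2.length_eq
  rw [List.length_append] at h
  simp only [List.length_cons, ge_succ]
  rw [← h]
  push_cast
  ring

theorem T_nonpos {α : Type} (a : α) (w : List α) :
    ((splits (a :: w)).map (fun p => ge p.1.length * ge p.2.length)).sum ≤ 0 := by
  induction w generalizing a with
  | nil => simp [splits, ge, gd]; norm_num
  | cons c w ih =>
    rw [T_succ]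
    refine mul_nonpos_of_nonneg_of_nonpos ?_ (ih c)
    simp

theorem sum_left {α : Type} (w : List α) (φ : ℕ → ℝ) :
    ((splits w).map (fun p => (if p.1.length = 0 then 2 else 0) * φ p.2.length)).sum
      = 2 * φ w.length := by
  induction w generalizing φ with
  | nil => simp [splits]
  | cons a w ih =>
    rw [splits_sum_cons]
    have := ih (fun n => φ (n + 1))
    simpa using this

theorem sum_right {α : Type} (w : List α) (φ : ℕ → ℝ) :
    ((splits w).map (fun p => φ p.1.length * (if p.2.length = 0 then 2 else 0))).sum
      = φ w.length * 2 := by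
  induction w generalizing φ with
  | nil => simp [splits]
  | cons a w ih =>
    rw [splits_sum_cons]
    have := ih (fun n => φ (n + 1))
    simpa using this

theorem S_le {α : Type} (w : List α) :
    ((splits w).map (fun p => gd p.1.length * gd p.2.length)).sum ≤ 4 * gd w.length := by
  rcases w with _ | ⟨a, w⟩
  · simp [splits, gd]
  · have e : ∀ p : List α × List α, gd p.1.length * gd p.2.length =
        ge p.1.length * ge p.2.length + ((if p.1.length = 0 then 2 else 0) * gd p.2.length
          + ge p.1.length * (if p.2.length = 0 then 2 else 0)) := by
      intro p; simp only [ge]; ring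
    simp only [e, List.sum_map_add]
    rw [sum_left, sum_right]
    have := T_nonpos a w
    have h2 : ge (a :: w).length = gd (a :: w).length := by simp [ge]
    rw [h2]
    linarith

/-! calculus -/

theorem line_diff {s : ℕ} (j : Fin s) (f : (Fin s → ℝ) → ℝ) (hf : ContDiff ℝ (⊤ : ℕ∞) f)
    (y : Fin s → ℝ) :
    DifferentiableAt ℝ (fun t : ℝ => f (y + t • (Pi.single j 1 : Fin s → ℝ))) 0 := by
  have : Differentiable ℝ f := hf.differentiable (by simp)
  fun_prop

theorem pd_eq {s : ℕ} (j : Fin s) (f : (Fin s → ℝ) → ℝ) (hf : ContDiff ℝ (⊤ : ℕ∞) f) :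
    pd j f = fun y => fderiv ℝ f y (Pi.single j 1) := by
  funext y
  have h : Differentiable ℝ f := hf.differentiable (by simp)
  exact ((h y).lineDeriv_eq_fderiv (v := Pi.single j 1))

theorem pd_contDiff {s : ℕ} (j : Fin s) (f : (Fin s → ℝ) → ℝ) (hf : ContDiff ℝ (⊤ : ℕ∞) f) :
    ContDiff ℝ (⊤ : ℕ∞) (pd j f) := by
  rw [pd_eq j f hf]
  exact (hf.fderiv_right (m := (⊤ : ℕ∞)) (by simp)).clm_apply contDiff_const

theorem Dw_contDiff {s : ℕ} (w : List (Fin s)) (f : (Fin s → ℝ) → ℝ)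
    (hf : ContDiff ℝ (⊤ : ℕ∞) f) : ContDiff ℝ (⊤ : ℕ∞) (Dw w f) := by
  induction w with
  | nil => exact hf
  | cons a w ih => exact pd_contDiff a _ ih

theorem pd_add {s : ℕ} (j : Fin s) (f g : (Fin s → ℝ) → ℝ) (hf : ContDiff ℝ (⊤ : ℕ∞) f)
    (hg : ContDiff ℝ (⊤ : ℕ∞) g) : pd j (fun z => f z + g z) = fun z => pd j f z + pd j g z := by
  funext y
  exact deriv_fun_add (line_diff j f hf y) (line_diff j g hg y)

theorem pd_mul {s : ℕ} (j : Fin s) (f g : (Fin s → ℝ) → ℝ) (hf : ContDiff ℝ (⊤ : ℕ∞) f)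
    (hg : ContDiff ℝ (⊤ : ℕ∞) g) :
    pd j (fun z => f z * g z) = fun z => pd j f z * g z + f z * pd j g z := by
  funext y
  have := deriv_fun_mul (line_diff j f hf y) (line_diff j g hg y)
  simpa [pd] using this

theorem pd_zero {s : ℕ} (j : Fin s) : pd j (fun _ => (0 : ℝ)) = fun _ => 0 := by
  funext y; simp [pd]

theorem Dw_sum {s : ℕ} {ι : Type} (w : List (Fin s)) (t : Finset ι)
    (F : ι → (Fin s → ℝ) → ℝ) (hF : ∀ i, ContDiff ℝ (⊤ : ℕ∞) (F i)) :
    Dw w (fun z => ∑ i ∈ t, F i z) = fun z => ∑ i ∈ t, Dw w (F i) z := by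
  induction w with
  | nil => rfl
  | cons a w ih =>
    change pd a (Dw w _) = _
    rw [ih]
    funext y
    exact deriv_fun_sum (fun i _ => line_diff a _ (Dw_contDiff w _ (hF i)) y)

theorem pd_splits {s : ℕ} (a : Fin s) (L : List (List (Fin s) × List (Fin s)))
    (f g : (Fin s → ℝ) → ℝ)
    (hf : ContDiff ℝ (⊤ : ℕ∞) f) (hg : ContDiff ℝ (⊤ : ℕ∞) g) :
    ContDiff ℝ (⊤ : ℕ∞) (fun z => (L.map (fun p => Dw p.1 f z * Dw p.2 g z)).sum) ∧
    pd a (fun z => (L.map (fun p => Dw p.1 f z * Dw p.2 g z)).sum) =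
      fun z => (L.map (fun p => Dw (a :: p.1) f z * Dw p.2 g z
        + Dw p.1 f z * Dw (a :: p.2) g z)).sum := by
  induction L with
  | nil => simpa [pd_zero] using contDiff_const
  | cons p L ih =>
    obtain ⟨h1, h2⟩ := ih
    have hf' := Dw_contDiff p.1 f hf
    have hg' := Dw_contDiff p.2 g hg
    simp only [List.map_cons, List.sum_cons]
    refine ⟨(hf'.mul hg').add h1, ?_⟩
    rw [pd_add a _ _ (hf'.mul hg') h1, h2, pd_mul a _ _ hf' hg']
    rfl

theorem Dw_mul {s : ℕ} (w : List (Fin s)) (f g : (Fin s → ℝ) → ℝ)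
    (hf : ContDiff ℝ (⊤ : ℕ∞) f) (hg : ContDiff ℝ (⊤ : ℕ∞) g) :
    Dw w (fun z => f z * g z) =
      fun z => ((splits w).map (fun p => Dw p.1 f z * Dw p.2 g z)).sum := by
  induction w with
  | nil => funext z; simp [splits, Dw]
  | cons a w ih =>
    change pd a (Dw w _) = _
    rw [ih, (pd_splits a (splits w) f g hf hg).2]
    funext z
    rw [splits_sum_cons]

/-! words and multi-indices -/

/-- canonical word -/
def word {s : ℕ} (ν : Fin s → ℕ) : List (Fin s) :=
  (List.finRange s).flatMap (fun j => List.replicate (ν j) j)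

theorem pdMulti_eq {s : ℕ} (ν : Fin s → ℕ) (f : (Fin s → ℝ) → ℝ) :
    pdMulti ν f = Dw (word ν) f := by
  unfold pdMulti Dw word
  have hr : ∀ (n : ℕ) (j : Fin s) (g : (Fin s → ℝ) → ℝ),
      (pd j)^[n] g = (List.replicate n j).foldr pd g := by
    intro n j g
    induction n with
    | zero => rfl
    | succ n ih => rw [Function.iterate_succ_apply', ih]; rfl
  induction List.finRange s with
  | nil => rfl
  | cons a l ih => rw [List.foldr_cons, ih, List.flatMap_cons, List.foldr_append, hr]

theorem word_count {s : ℕ} (ν : Fin s → ℕ) (j : Fin s) : (word ν).count j = ν j := by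
  unfold word
  rw [List.count_flatMap, ← List.ofFn_eq_map, List.sum_ofFn]
  simp [List.count_replicate]

theorem word_sorted {s : ℕ} (ν : Fin s → ℕ) : (word ν).Pairwise (· ≤ ·) := by
  unfold word
  rw [List.pairwise_flatMap]
  refine ⟨fun a _ => ?_, ?_⟩
  · simp [List.pairwise_replicate]
  · refine (List.pairwise_lt_finRange s).imp ?_
    intro a c hac x hx y hy
    rw [List.eq_of_mem_replicate hx, List.eq_of_mem_replicate hy]
    exact hac.le

theorem sorted_eq_word {s : ℕ} (w : List (Fin s)) (hw : w.Pairwise (· ≤ ·)) :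
    w = word (fun j => w.count j) := by
  refine List.Perm.eq_of_pairwise' hw (word_sorted _) ?_
  rw [List.perm_iff_count]
  intro a
  rw [word_count]

theorem prod_count {s : ℕ} (b : Fin s → ℝ) (w : List (Fin s)) :
    ∏ j, b j ^ w.count j = (w.map b).prod := by
  rw [Finset.prod_list_map_count]
  symm
  apply Finset.prod_subset (Finset.subset_univ _)
  intro x _ hx
  have : w.count x = 0 := List.count_eq_zero.2 (by simpa using hx)
  simp [this]

theorem sum_count {s : ℕ} (w : List (Fin s)) : ∑ j, w.count j = w.length := by
  induction w with
  | nil => simp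
  | cons a w ih => simp [List.count_cons, Finset.sum_add_distrib, ih]

/-! Frobenius norm -/

theorem frob_eq {d : ℕ} (A : Matrix (Fin d) (Fin d) ℝ) :
    frob A = @norm _ (Matrix.frobeniusNormedAddCommGroup).toNorm A := by
  rw [Matrix.frobenius_norm_def, frob, Real.sqrt_eq_rpow]
  simp

theorem frob_nonneg {d : ℕ} (A : Matrix (Fin d) (Fin d) ℝ) : 0 ≤ frob A := Real.sqrt_nonneg _

theorem frob_mul {d : ℕ} (A B : Matrix (Fin d) (Fin d) ℝ) : frob (A * B) ≤ frob A * frob B := by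
  simp only [frob_eq]
  exact Matrix.frobenius_norm_mul A B

theorem frob_add {d : ℕ} (A B : Matrix (Fin d) (Fin d) ℝ) : frob (A + B) ≤ frob A + frob B := by
  simp only [frob_eq]
  letI := Matrix.frobeniusNormedAddCommGroup (m := Fin d) (n := Fin d) (α := ℝ)
  exact norm_add_le A B

theorem frob_sum {d : ℕ} {ι : Type} (L : List ι) (A : ι → Matrix (Fin d) (Fin d) ℝ) :
    frob (L.map A).sum ≤ (L.map (fun p => frob (A p))).sum := by
  induction L with
  | nil => simp [frob]
  | cons p L ih =>
    simp only [List.map_cons, List.sum_cons]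
    exact (frob_add _ _).trans (by linarith)

/-- matrix derivative along a word -/
noncomputable def DwMat {s d : ℕ} (w : List (Fin s))
    (M : (Fin s → ℝ) → Matrix (Fin d) (Fin d) ℝ) (y : Fin s → ℝ) :
    Matrix (Fin d) (Fin d) ℝ :=
  Matrix.of fun i j => Dw w (fun z => M z i j) y

theorem pdMat_eq {s d : ℕ} (ν : Fin s → ℕ)
    (M : (Fin s → ℝ) → Matrix (Fin d) (Fin d) ℝ) (y : Fin s → ℝ) :
    pdMat ν M y = DwMat (word ν) M y := by
  simp only [pdMat, DwMat, pdMulti_eq]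

theorem list_sum_apply {d : ℕ} {ι : Type} (L : List ι) (A : ι → Matrix (Fin d) (Fin d) ℝ)
    (i j : Fin d) : (L.map A).sum i j = (L.map (fun p => A p i j)).sum := by
  induction L with
  | nil => rfl
  | cons p L ih => simp [Matrix.add_apply, ih]

theorem sum_list_comm {ι κ : Type} (t : Finset κ) (L : List ι) (F : κ → ι → ℝ) :
    ∑ k ∈ t, (L.map (F k)).sum = (L.map (fun p => ∑ k ∈ t, F k p)).sum := by
  induction L with
  | nil => simp
  | cons p L ih => simp [Finset.sum_add_distrib, ih]

theorem DwMat_mul {s d : ℕ} (w : List (Fin s))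
    (M K : (Fin s → ℝ) → Matrix (Fin d) (Fin d) ℝ)
    (hM : ∀ i j, ContDiff ℝ (⊤ : ℕ∞) fun y => M y i j)
    (hK : ∀ i j, ContDiff ℝ (⊤ : ℕ∞) fun y => K y i j) (y : Fin s → ℝ) :
    DwMat w (fun z => M z * K z) y =
      ((splits w).map (fun p => DwMat p.1 M y * DwMat p.2 K y)).sum := by
  ext i j
  rw [list_sum_apply]
  simp only [DwMat, Matrix.of_apply, Matrix.mul_apply]
  rw [Dw_sum w Finset.univ (fun k z => M z i k * K z k j) (fun k => (hM i k).mul (hK k j))]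
  simp only [Dw_mul w _ _ (hM i _) (hK _ j)]
  rw [sum_list_comm]

theorem word_bound {s d : ℕ} (δ : ℝ) (b : Fin s → ℝ)
    (M : (Fin s → ℝ) → Matrix (Fin d) (Fin d) ℝ) (C : ℝ)
    (hMb : ∀ (ν : Fin s → ℕ) (y : Fin s → ℝ),
      frob (pdMat ν M y)
        ≤ C * (∏ j, b j ^ ν j) * gd (∑ j, ν j) * ((∑ j, ν j).factorial : ℝ) ^ (δ - 1))
    (w : List (Fin s)) (hw : w.Pairwise (· ≤ ·)) (y : Fin s → ℝ) :
    frob (DwMat w M y) ≤ C * (w.map b).prod * gd w.length * (w.length.factorial : ℝ) ^ (δ - 1) := by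
  have h := hMb (fun j => w.count j) y
  rw [pdMat_eq, ← sorted_eq_word w hw, prod_count, sum_count] at h
  exact h

theorem stmt9 {s d : ℕ} (hs : 1 ≤ s) (hd : 1 ≤ d) (δ : ℝ) (hδ : 1 ≤ δ)
    (b : Fin s → ℝ) (hb : ∀ j, 0 < b j)
    (M K : (Fin s → ℝ) → Matrix (Fin d) (Fin d) ℝ)
    (hM : ∀ i j, ContDiff ℝ (⊤ : ℕ∞) fun y => M y i j)
    (hK : ∀ i j, ContDiff ℝ (⊤ : ℕ∞) fun y => K y i j)
    (CM CK : ℝ) (hCM : 1 ≤ CM) (hCK : 0 < CK)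
    (hMb : ∀ (ν : Fin s → ℕ) (y : Fin s → ℝ),
      frob (pdMat ν M y)
        ≤ CM * (∏ j, b j ^ ν j) * gd (∑ j, ν j) * ((∑ j, ν j).factorial : ℝ) ^ (δ - 1))
    (hKb : ∀ (ν : Fin s → ℕ) (y : Fin s → ℝ),
      frob (pdMat ν K y)
        ≤ CK * (∏ j, b j ^ ν j) * gd (∑ j, ν j) * ((∑ j, ν j).factorial : ℝ) ^ (δ - 1)) :
    ∀ (ν : Fin s → ℕ) (y : Fin s → ℝ),
      frob (pdMat ν (fun z => M z * K z) y)
        ≤ 4 * CM * CK * (∏ j, b j ^ ν j) * gd (∑ j, ν j) *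
            ((∑ j, ν j).factorial : ℝ) ^ (δ - 1) := by
  intro ν y
  have hν : ν = fun j => (word ν).count j := funext fun j => (word_count ν j).symm
  have hp : ∏ j, b j ^ ν j = ((word ν).map b).prod := by
    rw [← prod_count]; simp only [word_count]
  have hn : ∑ j, ν j = (word ν).length := by
    rw [← sum_count]; simp only [word_count]
  rw [pdMat_eq, hp, hn, DwMat_mul _ _ _ hM hK]
  have hw := word_sorted ν
  generalize word ν = w at hw
  set R : ℝ := (w.length.factorial : ℝ) ^ (δ - 1) with hR
  have hR0 : 0 ≤ R := Real.rpow_nonneg (Nat.cast_nonneg _) _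
  have hpos : ∀ l : List (Fin s), 0 ≤ (l.map b).prod := by
    intro l
    apply List.prod_nonneg
    intro x hx
    obtain ⟨j, _, rfl⟩ := List.mem_map.1 hx
    exact (hb j).le
  have key : ∀ p ∈ splits w, frob (DwMat p.1 M y * DwMat p.2 K y) ≤
      (CM * CK * (w.map b).prod * R) * (gd p.1.length * gd p.2.length) := by
    intro p hp
    obtain ⟨h1, h2, h3⟩ := mem_splits w p hp
    have e1 := word_bound δ b M CM hMb p.1 (hw.sublist h1) y
    have e2 := word_bound δ b K CK hKb p.2 (hw.sublist h2) y
    have hprod : (w.map b).prod = (p.1.map b).prod * (p.2.map b).prod := by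
      rw [← List.prod_append, ← List.map_append]
      exact ((h3.map b).prod_eq).symm
    have hlen : p.1.length + p.2.length = w.length := by
      rw [← List.length_append]; exact h3.length_eq
    have hfac : (p.1.length.factorial : ℝ) ^ (δ - 1) * (p.2.length.factorial : ℝ) ^ (δ - 1) ≤ R := by
      rw [← Real.mul_rpow (Nat.cast_nonneg _) (Nat.cast_nonneg _), hR, ← hlen]
      apply Real.rpow_le_rpow (by positivity) _ (by linarith)
      exact_mod_cast Nat.le_of_dvd (Nat.factorial_pos _)
        (Nat.factorial_mul_factorial_dvd_factorial_add _ _)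
    have hq : 0 ≤ CM * CK * (w.map b).prod * (gd p.1.length * gd p.2.length) :=
      mul_nonneg (mul_nonneg (mul_nonneg (by linarith) hCK.le) (hpos w))
        (mul_nonneg (gd_nonneg _) (gd_nonneg _))
    calc frob (DwMat p.1 M y * DwMat p.2 K y)
        ≤ frob (DwMat p.1 M y) * frob (DwMat p.2 K y) := frob_mul _ _
      _ ≤ _ := mul_le_mul e1 e2 (frob_nonneg _) ((frob_nonneg _).trans e1)
      _ = CM * CK * (w.map b).prod * (gd p.1.length * gd p.2.length) *
          ((p.1.length.factorial : ℝ) ^ (δ - 1) * (p.2.length.factorial : ℝ) ^ (δ - 1)) := by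
          rw [hprod]; ring
      _ ≤ CM * CK * (w.map b).prod * (gd p.1.length * gd p.2.length) * R :=
          mul_le_mul_of_nonneg_left hfac hq
      _ = _ := by ring
  calc _ ≤ ((splits w).map (fun p => frob (DwMat p.1 M y * DwMat p.2 K y))).sum := frob_sum _ _
    _ ≤ ((splits w).map (fun p => (CM * CK * (w.map b).prod * R) *
          (gd p.1.length * gd p.2.length))).sum := List.sum_le_sum key
    _ = (CM * CK * (w.map b).prod * R) *
          ((splits w).map (fun p => gd p.1.length * gd p.2.length)).sum :=
        List.sum_map_mul_left ..
    _ ≤ (CM * CK * (w.map b).prod * R) * (4 * gd w.length) :=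
        mul_le_mul_of_nonneg_left (S_le w)
          (mul_nonneg (mul_nonneg (mul_nonneg (by linarith) hCK.le) (hpos w)) hR0)
    _ = _ := by ring
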